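/- Let 𝕂 be ℝ or ℂ. Suppose A : Matrix (Fin M) (Fin N) 𝕂 satisfies the (3s)-sparse RIP with constant δ_A and B : Matrix (Fin m) (Fin n) 𝕂 satisfies the (2σ)-sparse RIP with constant δ_B, where 0 ≤ δ_A < √((√3+1)/√3) − 1 and 0 ≤ δ_B < √((√3+1)/√3) − 1. Then δ := δ_A + δ_B + δ_A·δ_B satisfies δ < 1/√3, and for every (3s,2σ)-hierarchically sparse vector x : Fin N × Fin n → 𝕂 one has (1−δ)·‖x‖² ≤ ‖(A ⊗ B).mulVec x‖² ≤ (1+δ)·‖x‖². (The HiRIP-constant estimate underlying the paper's Corollary 1, which guarantees convergence of HiHTP for Kronecker product measurements.) -/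

import Mathlib

open scoped BigOperators

/-- Squared ℓ2 (Euclidean) norm of a vector. -/
def sqNorm {𝕂 : Type*} [RCLike 𝕂] {ι : Type*} [Fintype ι] (x : ι → 𝕂) : ℝ :=
  ∑ i, ‖x i‖ ^ 2

/-- `M` satisfies the `s`-sparse restricted isometry property with constant `δ ≥ 0`. -/
def SparseRIP {𝕂 : Type*} [RCLike 𝕂] {ι κ : Type*} [Fintype ι] [Fintype κ]
    (M : Matrix κ ι 𝕂) (s : ℕ) (δ : ℝ) : Prop :=
  0 ≤ δ ∧ ∀ x : ι → 𝕂, (Function.support x).ncard ≤ s →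
    (1 - δ) * sqNorm x ≤ sqNorm (M.mulVec x) ∧
      sqNorm (M.mulVec x) ≤ (1 + δ) * sqNorm x

/-- `x`, viewed as `N` blocks `x_i = x (i, ·)`, is `(s,σ)`-hierarchically sparse:
at most `s` blocks are nonzero and each block has at most `σ` nonzero entries. -/
def HiSparse {𝕂 : Type*} [RCLike 𝕂] {N n : ℕ} (x : Fin N × Fin n → 𝕂) (s σ : ℕ) : Prop :=
  (Function.support (fun i : Fin N => (fun j : Fin n => x (i, j)))).ncard ≤ s ∧
    ∀ i : Fin N, (Function.support (fun j : Fin n => x (i, j))).ncard ≤ σ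

/-- The squared norm of a vector on a product index set is the sum over its rows. -/
lemma sqNorm_prod {𝕂 : Type*} [RCLike 𝕂] {ι κ : Type*} [Fintype ι] [Fintype κ]
    (x : ι × κ → 𝕂) : sqNorm x = ∑ i, sqNorm (fun k => x (i, k)) := by
  simp only [sqNorm, Fintype.sum_prod_type]

/-- The squared norm of a vector on a product index set is the sum over its columns. -/
lemma sqNorm_prod_right {𝕂 : Type*} [RCLike 𝕂] {ι κ : Type*} [Fintype ι] [Fintype κ]
    (x : ι × κ → 𝕂) : sqNorm x = ∑ k, sqNorm (fun i => x (i, k)) := by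
  simp only [sqNorm, Fintype.sum_prod_type_right]

lemma sqNorm_nonneg {𝕂 : Type*} [RCLike 𝕂] {ι : Type*} [Fintype ι] (x : ι → 𝕂) :
    0 ≤ sqNorm x :=
  Finset.sum_nonneg fun _ _ => sq_nonneg _

/-- A Kronecker product acts by applying `B` to each row, then `A` to each column. -/
lemma kroneckerMap_mulVec_apply {R : Type*} [CommSemiring R] {ι κ ι' κ' : Type*}
    [Fintype ι'] [Fintype κ'] (A : Matrix ι ι' R) (B : Matrix κ κ' R)
    (x : ι' × κ' → R) (i : ι) (k : κ) :
    (Matrix.kroneckerMap (· * ·) A B).mulVec x (i, k) =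
      A.mulVec (fun j => B.mulVec (fun l => x (j, l)) k) i := by
  simp only [Matrix.mulVec, dotProduct, Matrix.kroneckerMap_apply, Fintype.sum_prod_type,
    Finset.mul_sum, mul_assoc]

/-- Two-sided bound for `A ⊗ B` on hierarchically sparse vectors, with product constants. -/
lemma sqNorm_kroneckerMap_mulVec_bounds {𝕂 : Type*} [RCLike 𝕂] {M N m n : ℕ}
    {A : Matrix (Fin M) (Fin N) 𝕂} {B : Matrix (Fin m) (Fin n) 𝕂}
    {s σ : ℕ} {δA δB : ℝ} (hA : SparseRIP A s δA) (hB : SparseRIP B σ δB) (hδA : δA ≤ 1)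
    {x : Fin N × Fin n → 𝕂} (hx : HiSparse x s σ) :
    (1 - δA) * ((1 - δB) * sqNorm x) ≤
        sqNorm ((Matrix.kroneckerMap (· * ·) A B).mulVec x) ∧
      sqNorm ((Matrix.kroneckerMap (· * ·) A B).mulVec x) ≤
        (1 + δA) * ((1 + δB) * sqNorm x) := by
  set z : Fin N × Fin m → 𝕂 := fun p => B.mulVec (fun l => x (p.1, l)) p.2 with hz
  have hcol : ∀ k, (Function.support fun j => z (j, k)).ncard ≤ s := by
    intro k
    refine (Set.ncard_le_ncard ?_ (Set.toFinite _)).trans hx.1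
    intro j hj hxj
    apply hj
    have hxj' : (fun l => x (j, l)) = 0 := hxj
    simp [hz, hxj']
  have hy : sqNorm ((Matrix.kroneckerMap (· * ·) A B).mulVec x) =
      ∑ k, sqNorm (A.mulVec fun j => z (j, k)) := by
    rw [sqNorm_prod_right]
    simp only [kroneckerMap_mulVec_apply, hz]
  have hzrow : sqNorm z = ∑ j, sqNorm (B.mulVec fun l => x (j, l)) := sqNorm_prod z
  have hzl : (1 - δB) * sqNorm x ≤ sqNorm z := by
    rw [hzrow, sqNorm_prod x, Finset.mul_sum]
    exact Finset.sum_le_sum fun j _ => (hB.2 _ (hx.2 j)).1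
  have hzu : sqNorm z ≤ (1 + δB) * sqNorm x := by
    rw [hzrow, sqNorm_prod x, Finset.mul_sum]
    exact Finset.sum_le_sum fun j _ => (hB.2 _ (hx.2 j)).2
  rw [hy]
  constructor
  · refine (mul_le_mul_of_nonneg_left hzl (sub_nonneg.2 hδA)).trans ?_
    rw [sqNorm_prod_right z, Finset.mul_sum]
    exact Finset.sum_le_sum fun k _ => (hA.2 _ (hcol k)).1
  · refine le_trans ?_ (mul_le_mul_of_nonneg_left hzu (by linarith [hA.1]))
    rw [sqNorm_prod_right z, Finset.mul_sum]
    exact Finset.sum_le_sum fun k _ => (hA.2 _ (hcol k)).2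

/-- **HiRIP-constant estimate underlying Corollary 1.**
If `A` has `(3s)`-sparse RIP and `B` has `(2σ)`-sparse RIP, both with constants strictly
below `√((√3+1)/√3) − 1`, then `δ = δA + δB + δA·δB < 1/√3` and `A ⊗ B` acts as a
restricted isometry with constant `δ` on all `(3s,2σ)`-hierarchically sparse vectors. -/
theorem kronecker_hiRIP_constant {𝕂 : Type*} [RCLike 𝕂] {M N m n : ℕ}
    (A : Matrix (Fin M) (Fin N) 𝕂) (B : Matrix (Fin m) (Fin n) 𝕂)
    {s σ : ℕ} {δA δB : ℝ}
    (hA : SparseRIP A (3 * s) δA) (hB : SparseRIP B (2 * σ) δB)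
    (hδA : δA < Real.sqrt ((Real.sqrt 3 + 1) / Real.sqrt 3) - 1)
    (hδB : δB < Real.sqrt ((Real.sqrt 3 + 1) / Real.sqrt 3) - 1) :
    δA + δB + δA * δB < 1 / Real.sqrt 3 ∧
      ∀ x : Fin N × Fin n → 𝕂, HiSparse x (3 * s) (2 * σ) →
        (1 - (δA + δB + δA * δB)) * sqNorm x ≤
            sqNorm ((Matrix.kroneckerMap (· * ·) A B).mulVec x) ∧
          sqNorm ((Matrix.kroneckerMap (· * ·) A B).mulVec x) ≤
            (1 + (δA + δB + δA * δB)) * sqNorm x := by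
  have h3 : (1 : ℝ) ≤ Real.sqrt 3 := Real.one_le_sqrt.2 (by norm_num)
  have hpos : 0 < Real.sqrt 3 := by linarith
  set c := Real.sqrt ((Real.sqrt 3 + 1) / Real.sqrt 3)
  have hc : c * c = 1 + 1 / Real.sqrt 3 := by
    rw [Real.mul_self_sqrt (by positivity)]
    field_simp
  have hinv : 1 / Real.sqrt 3 ≤ 1 := (div_le_one hpos).2 h3
  have hA0 := hA.1
  have hB0 := hB.1
  have hδ : δA + δB + δA * δB < 1 / Real.sqrt 3 := by
    have : (1 + δA) * (1 + δB) < c * c :=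
      mul_lt_mul'' (by linarith) (by linarith) (by linarith) (by linarith)
    linarith
  refine ⟨hδ, fun x hx => ?_⟩
  have hAB : 0 ≤ δA * δB := mul_nonneg hA0 hB0
  obtain ⟨hl, hu⟩ := sqNorm_kroneckerMap_mulVec_bounds hA hB (by linarith) hx
  have hxAB : 0 ≤ δA * δB * sqNorm x := mul_nonneg hAB (sqNorm_nonneg x)
  constructor <;> linarith
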